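/- arXiv:2511.20805 — 3 statements merged into one kernel-verified Lean document; each statement's English description precedes it below -/
import Mathlib

section
/- Let d ≥ 2 and m ≥ 1 be integers, and let x₁, x₂, x₃, x₄ be nonnegative integers with x₁ + x₂ < m, x₃ + x₄ < m, x₁ + x₄ < d, x₂ + x₃ < d. Let Q be the convex hull of the eight points (x₁, d), (m − x₂, d), (m, d − x₂), (m, x₃), (m − x₃, 0), (x₄, 0), (0, x₄), (0, d − x₁) (the rectangle [0, m] × [0, d] with an isosceles right triangle of leg x_i removed at each corner: leg x₁ at (0, d), x₂ at (m, d), x₃ at (m, 0), x₄ at (0, 0)). Let g be the number of interior lattice points of Q and r(Q) the number of boundary lattice points of Q. Then g + r(Q) − 3 = U(g, d) + 2 + Σ_{i=1}^{4} x_i(x_i − d)/(d − 1), where U(g, d) = g + 2g/(d − 1) + 2d − 3. -/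
open Set

noncomputable section

/-- Embedding of the integer lattice `ℤ × ℤ` into the real plane. -/
def latticeEmbed (p : ℤ × ℤ) : ℝ × ℝ := ((p.1 : ℝ), (p.2 : ℝ))

/-- A lattice polygon: the convex hull of a nonempty finite set of lattice points. -/
def IsLatticePolygon (P : Set (ℝ × ℝ)) : Prop :=
  ∃ S : Finset (ℤ × ℤ), S.Nonempty ∧
    P = convexHull ℝ (latticeEmbed '' (S : Set (ℤ × ℤ)))

/-- The interior lattice points of a set in the plane. -/
def interiorLatticePoints (P : Set (ℝ × ℝ)) : Set (ℤ × ℤ) :=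
  {p : ℤ × ℤ | latticeEmbed p ∈ interior P}

/-- The genus of a lattice polygon: the number of interior lattice points. -/
def polygonGenus (P : Set (ℝ × ℝ)) : ℕ := (interiorLatticePoints P).ncard

/-- The number of lattice points on the boundary. -/
def boundaryLatticeCount (P : Set (ℝ × ℝ)) : ℕ :=
  {p : ℤ × ℤ | latticeEmbed p ∈ frontier P}.ncard

/-- A subset of the plane is two-dimensional if it has nonempty interior. -/
def TwoDimensional (P : Set (ℝ × ℝ)) : Prop := (interior P).Nonempty

/-- A `ℤ`-affine transformation of the plane: `p ↦ A p + b` with `A ∈ GL₂(ℤ)`, `b ∈ ℤ²`. -/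
def IsZAffine (φ : ℝ × ℝ → ℝ × ℝ) : Prop :=
  ∃ a b c d e f : ℤ, (a * d - b * c = 1 ∨ a * d - b * c = -1) ∧
    ∀ p : ℝ × ℝ,
      φ p = ((a : ℝ) * p.1 + (b : ℝ) * p.2 + (e : ℝ),
             (c : ℝ) * p.1 + (d : ℝ) * p.2 + (f : ℝ))

/-- The horizontal strip `ℝ × [0, s]`. -/
def strip (s : ℝ) : Set (ℝ × ℝ) := {q : ℝ × ℝ | 0 ≤ q.2 ∧ q.2 ≤ s}

/-- `LatticeWidthIs P d` : `d` is the smallest positive integer `s` such that some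
`ℤ`-affine transformation maps `P` into the strip `ℝ × [0, s]`. -/
def LatticeWidthIs (P : Set (ℝ × ℝ)) (d : ℕ) : Prop :=
  IsLeast {s : ℕ | 0 < s ∧ ∃ φ, IsZAffine φ ∧ φ '' P ⊆ strip (s : ℝ)} d

/-- An edge of a polygon: an exposed face of dimension one. -/
def IsEdge (P τ : Set (ℝ × ℝ)) : Prop :=
  IsExposed ℝ P τ ∧ Module.finrank ℝ (vectorSpan ℝ τ) = 1

/-- A column vector of a polygon `P`: a nonzero integer vector `v` such that for some
edge `τ` of `P`, translating all lattice points of `P` off `τ` by `v` stays in `P`. -/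
def IsColumnVector (P : Set (ℝ × ℝ)) (v : ℤ × ℤ) : Prop :=
  v ≠ 0 ∧ ∃ τ : Set (ℝ × ℝ), IsEdge P τ ∧
    ∀ p : ℤ × ℤ, latticeEmbed p ∈ P \ τ → latticeEmbed (p + v) ∈ P

/-- The number of column vectors of `P`. -/
def columnVectorCount (P : Set (ℝ × ℝ)) : ℕ :=
  {v : ℤ × ℤ | IsColumnVector P v}.ncard

/-- A lattice polygon is maximal if no lattice polygon strictly containing it has the
same set of interior lattice points. -/
def IsMaximalPolygon (P : Set (ℝ × ℝ)) : Prop :=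
  IsLatticePolygon P ∧
    ∀ Q : Set (ℝ × ℝ), IsLatticePolygon Q → P ⊆ Q →
      interiorLatticePoints Q = interiorLatticePoints P → Q = P

/-- The interior polygon: the convex hull of the interior lattice points. -/
def interiorPolygon (P : Set (ℝ × ℝ)) : Set (ℝ × ℝ) :=
  convexHull ℝ (latticeEmbed '' interiorLatticePoints P)

/-- A lattice polygon is non-hyperelliptic if its interior polygon is two-dimensional. -/
def NonHyperelliptic (P : Set (ℝ × ℝ)) : Prop := TwoDimensional (interiorPolygon P)

/-- Two polygons are equivalent if one is the image of the other under a
`ℤ`-affine transformation. -/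
def EquivPolygon (P Q : Set (ℝ × ℝ)) : Prop := ∃ φ, IsZAffine φ ∧ φ '' P = Q

/-- The triangle `2Υ = conv{(−2,−2),(2,0),(0,2)}`. -/
def twoUpsilon : Set (ℝ × ℝ) :=
  convexHull ℝ {((-2 : ℝ), (-2 : ℝ)), ((2 : ℝ), (0 : ℝ)), ((0 : ℝ), (2 : ℝ))}

/-- `ExpectedGonalityIs P d` : the expected gonality of `P` is `d`, i.e.
`d = lw(P⁽¹⁾) + 2`, except that polygons equivalent to `2Υ` have expected gonality `3`. -/
def ExpectedGonalityIs (P : Set (ℝ × ℝ)) (d : ℕ) : Prop :=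
  (EquivPolygon P twoUpsilon ∧ d = 3) ∨
  (¬ EquivPolygon P twoUpsilon ∧
    ∃ w : ℕ, LatticeWidthIs (interiorPolygon P) w ∧ d = w + 2)

/-- `Q` contains a crystal of length `d`: a `(d+1) × (d−1)` grid of interior lattice
points occupying columns `x₀, …, x₀ + d` and rows `1, …, d − 1`. -/
def ContainsCrystal (Q : Set (ℝ × ℝ)) (d : ℕ) : Prop :=
  ∃ x₀ : ℤ, ∀ i j : ℤ, 0 ≤ i → i ≤ (d : ℤ) → 1 ≤ j → j ≤ (d : ℤ) - 1 →
    (x₀ + i, j) ∈ interiorLatticePoints Q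

/-- The shear transformation `(x, y) ↦ (x + ℓ y, y)`. -/
def shearMap (ℓ : ℤ) : ℝ × ℝ → ℝ × ℝ := fun q => (q.1 + (ℓ : ℝ) * q.2, q.2)

end

/-- The rectangle `[0, m] × [0, d]` with isosceles right corner triangles of legs `xᵢ`
removed. -/
def truncRectIso (d m x₁ x₂ x₃ x₄ : ℕ) : Set (ℝ × ℝ) :=
  convexHull ℝ {((x₁ : ℝ), (d : ℝ)), ((m : ℝ) - (x₂ : ℝ), (d : ℝ)),
    ((m : ℝ), (d : ℝ) - (x₂ : ℝ)), ((m : ℝ), (x₃ : ℝ)),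
    ((m : ℝ) - (x₃ : ℝ), (0 : ℝ)), ((x₄ : ℝ), (0 : ℝ)),
    ((0 : ℝ), (x₄ : ℝ)), ((0 : ℝ), (d : ℝ) - (x₁ : ℝ))}

lemma seg_aux {s : Set (ℝ × ℝ)} (hs : Convex ℝ s) (a b a' b' w1 w2 k t : ℝ)
    (h1 : (a, b) ∈ s) (h2 : (a', b') ∈ s) (ha : a' = a + k * w1) (hb : b' = b + k * w2)
    (h0 : 0 ≤ t) (hk : t ≤ k) (x y : ℝ) (hx : x = a + t * w1) (hy : y = b + t * w2) :
    (x, y) ∈ s := by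
  subst ha hb hx hy
  rcases eq_or_lt_of_le (h0.trans hk) with h | h
  · have : t = 0 := by linarith
    subst this
    simpa using h1
  · have := hs h1 h2 (a := 1 - t / k) (b := t / k)
      (by rw [sub_nonneg, div_le_one h]; exact hk) (by positivity) (by ring)
    convert this using 1
    ext
    · simp; field_simp; ring
    · simp; field_simp; ring

def octR (d m x₁ x₂ x₃ x₄ : ℝ) : Set (ℝ × ℝ) :=
  {q | 0 ≤ q.1 ∧ q.1 ≤ m ∧ 0 ≤ q.2 ∧ q.2 ≤ d ∧ x₄ ≤ q.1 + q.2 ∧ q.1 + q.2 ≤ m + d - x₂ ∧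
    q.2 - q.1 ≤ d - x₁ ∧ q.1 - q.2 ≤ m - x₃}

lemma hull_eq (d m x₁ x₂ x₃ x₄ : ℕ)
    (hx12 : x₁ + x₂ < m) (hx34 : x₃ + x₄ < m)
    (hx14 : x₁ + x₄ < d) (hx23 : x₂ + x₃ < d) :
    truncRectIso d m x₁ x₂ x₃ x₄ = octR d m x₁ x₂ x₃ x₄ := by
  have c1 : (x₁ : ℝ) + x₂ < m := by exact_mod_cast hx12
  have c2 : (x₃ : ℝ) + x₄ < m := by exact_mod_cast hx34
  have c3 : (x₁ : ℝ) + x₄ < d := by exact_mod_cast hx14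
  have c4 : (x₂ : ℝ) + x₃ < d := by exact_mod_cast hx23
  have p1 : (0 : ℝ) ≤ x₁ := by positivity
  have p2 : (0 : ℝ) ≤ x₂ := by positivity
  have p3 : (0 : ℝ) ≤ x₃ := by positivity
  have p4 : (0 : ℝ) ≤ x₄ := by positivity
  apply le_antisymm
  · apply convexHull_min
    · rintro q hq
      simp only [Set.mem_insert_iff, Set.mem_singleton_iff] at hq
      rcases hq with rfl | rfl | rfl | rfl | rfl | rfl | rfl | rfl <;>
        simp only [octR, Set.mem_ofPred_eq] <;> refine ⟨?_, ?_, ?_, ?_, ?_, ?_, ?_, ?_⟩ <;> linarith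
    · rintro ⟨a, b⟩ ⟨h1, h2, h3, h4, h5, h6, h7, h8⟩ ⟨a', b'⟩ ⟨k1, k2, k3, k4, k5, k6, k7, k8⟩
        s t hs ht hst
      obtain rfl : t = 1 - s := by linarith
      simp only at *
      simp only [octR, Set.mem_ofPred_eq, Prod.smul_mk, Prod.mk_add_mk, smul_eq_mul]
      refine ⟨?_, ?_, ?_, ?_, ?_, ?_, ?_, ?_⟩ <;> nlinarith
  · rintro ⟨x, y⟩ ⟨h1, h2, h3, h4, h5, h6, h7, h8⟩
    simp only at h1 h2 h3 h4 h5 h6 h7 h8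
    have hc : Convex ℝ (truncRectIso d m x₁ x₂ x₃ x₄) := convex_convexHull ℝ _
    have v1 : ((x₁ : ℝ), (d : ℝ)) ∈ truncRectIso d m x₁ x₂ x₃ x₄ :=
      subset_convexHull ℝ _ (by simp)
    have v2 : ((m : ℝ) - x₂, (d : ℝ)) ∈ truncRectIso d m x₁ x₂ x₃ x₄ :=
      subset_convexHull ℝ _ (by simp)
    have v3 : ((m : ℝ), (d : ℝ) - x₂) ∈ truncRectIso d m x₁ x₂ x₃ x₄ :=
      subset_convexHull ℝ _ (by simp)
    have v4 : ((m : ℝ), (x₃ : ℝ)) ∈ truncRectIso d m x₁ x₂ x₃ x₄ :=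
      subset_convexHull ℝ _ (by simp)
    have v5 : ((m : ℝ) - x₃, (0 : ℝ)) ∈ truncRectIso d m x₁ x₂ x₃ x₄ :=
      subset_convexHull ℝ _ (by simp)
    have v6 : ((x₄ : ℝ), (0 : ℝ)) ∈ truncRectIso d m x₁ x₂ x₃ x₄ :=
      subset_convexHull ℝ _ (by simp)
    have v7 : ((0 : ℝ), (x₄ : ℝ)) ∈ truncRectIso d m x₁ x₂ x₃ x₄ :=
      subset_convexHull ℝ _ (by simp)
    have v8 : ((0 : ℝ), (d : ℝ) - x₁) ∈ truncRectIso d m x₁ x₂ x₃ x₄ :=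
      subset_convexHull ℝ _ (by simp)
    have hl : ∃ l ≤ x, (l, y) ∈ truncRectIso d m x₁ x₂ x₃ x₄ := by
      rcases le_total y x₄ with h | h
      · exact ⟨x₄ - y, by linarith, seg_aux hc _ _ _ _ (-1) 1 x₄ y v6 v7 (by ring) (by ring)
          h3 h _ _ (by ring) (by ring)⟩
      rcases le_total y (d - x₁) with h' | h'
      · exact ⟨0, h1, seg_aux hc _ _ _ _ 0 1 (d - x₁ - x₄) (y - x₄) v7 v8 (by ring) (by ring)
          (by linarith) (by linarith) _ _ (by ring) (by ring)⟩
      · exact ⟨y - d + x₁, by linarith, seg_aux hc _ _ _ _ 1 1 x₁ (y - d + x₁) v8 v1 (by ring)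
          (by ring) (by linarith) (by linarith) _ _ (by ring) (by ring)⟩
    have hr : ∃ r ≥ x, (r, y) ∈ truncRectIso d m x₁ x₂ x₃ x₄ := by
      rcases le_total y x₃ with h | h
      · exact ⟨m - x₃ + y, by linarith, seg_aux hc _ _ _ _ 1 1 x₃ y v5 v4 (by ring) (by ring)
          h3 h _ _ (by ring) (by ring)⟩
      rcases le_total y (d - x₂) with h' | h'
      · exact ⟨m, h2, seg_aux hc _ _ _ _ 0 1 (d - x₂ - x₃) (y - x₃) v4 v3 (by ring) (by ring)
          (by linarith) (by linarith) _ _ (by ring) (by ring)⟩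
      · exact ⟨m - (y - d + x₂), by linarith, seg_aux hc _ _ _ _ (-1) 1 x₂ (y - d + x₂) v3 v2
          (by ring) (by ring) (by linarith) (by linarith) _ _ (by ring) (by ring)⟩
    obtain ⟨l, hl, hl'⟩ := hl
    obtain ⟨r, hr, hr'⟩ := hr
    exact seg_aux hc _ _ _ _ 1 0 (r - l) (x - l) hl' hr' (by ring) (by ring)
      (by linarith) (by linarith) _ _ (by ring) (by ring)

lemma int_half (a b c : ℝ) (h : a ≠ 0 ∨ b ≠ 0) :
    interior {q : ℝ × ℝ | a * q.1 + b * q.2 ≤ c} = {q | a * q.1 + b * q.2 < c} := by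
  let f : ℝ × ℝ →L[ℝ] ℝ := a • ContinuousLinearMap.fst ℝ ℝ ℝ + b • ContinuousLinearMap.snd ℝ ℝ ℝ
  have hf : ∀ q, f q = a * q.1 + b * q.2 := fun q => by simp [f]
  have hs : Function.Surjective f := by
    intro z
    rcases h with h | h
    · exact ⟨(z / a, 0), by rw [hf]; field_simp; simp⟩
    · exact ⟨(0, z / b), by rw [hf]; field_simp; simp⟩
  have := (f.isOpenMap hs).preimage_interior_eq_interior_preimage f.continuous (Set.Iic c)
  rw [interior_Iic] at this
  have e1 : {q : ℝ × ℝ | a * q.1 + b * q.2 ≤ c} = f ⁻¹' Set.Iic c := by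
    ext q; simp [hf]
  rw [e1, ← this]
  ext q; simp [hf]

lemma octR_eq (d m x₁ x₂ x₃ x₄ : ℝ) : octR d m x₁ x₂ x₃ x₄ =
    {q | (-1) * q.1 + 0 * q.2 ≤ 0} ∩ ({q | 1 * q.1 + 0 * q.2 ≤ m} ∩
    ({q | 0 * q.1 + (-1) * q.2 ≤ 0} ∩ ({q | 0 * q.1 + 1 * q.2 ≤ d} ∩
    ({q | (-1) * q.1 + (-1) * q.2 ≤ -x₄} ∩ ({q | 1 * q.1 + 1 * q.2 ≤ m + d - x₂} ∩
    ({q | (-1) * q.1 + 1 * q.2 ≤ d - x₁} ∩ {q | 1 * q.1 + (-1) * q.2 ≤ m - x₃})))))) := by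
  ext q
  simp only [octR, Set.mem_ofPred_eq, Set.mem_inter_iff]
  constructor
  · rintro ⟨h1, h2, h3, h4, h5, h6, h7, h8⟩
    refine ⟨?_, ?_, ?_, ?_, ?_, ?_, ?_, ?_⟩ <;> linarith
  · rintro ⟨h1, h2, h3, h4, h5, h6, h7, h8⟩
    refine ⟨?_, ?_, ?_, ?_, ?_, ?_, ?_, ?_⟩ <;> linarith

lemma int_octR (d m x₁ x₂ x₃ x₄ : ℝ) (q : ℝ × ℝ) : q ∈ interior (octR d m x₁ x₂ x₃ x₄) ↔
    0 < q.1 ∧ q.1 < m ∧ 0 < q.2 ∧ q.2 < d ∧ x₄ < q.1 + q.2 ∧ q.1 + q.2 < m + d - x₂ ∧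
    q.2 - q.1 < d - x₁ ∧ q.1 - q.2 < m - x₃ := by
  rw [octR_eq]
  simp only [interior_inter]
  rw [int_half _ _ _ (by norm_num), int_half _ _ _ (by norm_num), int_half _ _ _ (by norm_num),
    int_half _ _ _ (by norm_num), int_half _ _ _ (by norm_num), int_half _ _ _ (by norm_num),
    int_half _ _ _ (by norm_num), int_half _ _ _ (by norm_num)]
  simp only [Set.mem_ofPred_eq, Set.mem_inter_iff]
  constructor
  · rintro ⟨h1, h2, h3, h4, h5, h6, h7, h8⟩
    refine ⟨?_, ?_, ?_, ?_, ?_, ?_, ?_, ?_⟩ <;> linarith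
  · rintro ⟨h1, h2, h3, h4, h5, h6, h7, h8⟩
    refine ⟨?_, ?_, ?_, ?_, ?_, ?_, ?_, ?_⟩ <;> linarith

lemma closed_octR (d m x₁ x₂ x₃ x₄ : ℝ) : IsClosed (octR d m x₁ x₂ x₃ x₄) := by
  rw [octR_eq]
  repeat' apply IsClosed.inter
  all_goals exact isClosed_le (by fun_prop) (by fun_prop)

def tri (a : ℕ) : Finset (ℕ × ℕ) :=
  (Finset.range a ×ˢ Finset.range a).filter (fun z => z.1 + z.2 < a)

lemma tri_card (a : ℕ) : 2 * (tri a).card = a * (a + 1) := by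
  have : (tri a).card = ∑ i ∈ Finset.range a, (a - i) := by
    rw [tri, Finset.card_filter, Finset.sum_product]
    apply Finset.sum_congr rfl
    intro i hi
    rw [← Finset.card_filter]
    have : (Finset.range a).filter (fun j => i + j < a) = Finset.range (a - i) := by
      ext j; simp; omega
    rw [this, Finset.card_range]
  rw [this]
  clear this
  induction a with
  | zero => simp
  | succ n ih =>
    rw [Finset.sum_range_succ', mul_add]
    simp only [Nat.add_sub_add_right, ih]
    simp; ring

def goodF (p q a₁ a₂ a₃ a₄ : ℕ) : Finset (ℕ × ℕ) :=
  (Finset.range p ×ˢ Finset.range q).filter (fun z =>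
    a₄ ≤ z.1 + z.2 ∧ a₃ ≤ (p - 1 - z.1) + z.2 ∧ a₂ ≤ (p - 1 - z.1) + (q - 1 - z.2) ∧
    a₁ ≤ z.1 + (q - 1 - z.2))

lemma goodF_card (p q a₁ a₂ a₃ a₄ : ℕ) (h12 : a₁ + a₂ ≤ p) (h34 : a₃ + a₄ ≤ p)
    (h14 : a₁ + a₄ ≤ q) (h23 : a₂ + a₃ ≤ q) (h13 : a₁ + a₃ < p + q) (h24 : a₂ + a₄ < p + q) :
    (goodF p q a₁ a₂ a₃ a₄).card + (tri a₁).card + (tri a₂).card + (tri a₃).card + (tri a₄).card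
      = p * q := by
  let R := Finset.range p ×ˢ Finset.range q
  have t4 : (tri a₄).card = (R.filter (fun z => z.1 + z.2 < a₄)).card := by
    apply Finset.card_nbij' (fun z => z) (fun z => z)
    all_goals
      rintro ⟨i, j⟩ h
      simp only [tri, R, Finset.coe_filter, Finset.mem_product, Finset.mem_range,
        Set.mem_ofPred_eq, Prod.mk.injEq, and_true, true_and] at h ⊢
      try omega
  have t3 : (tri a₃).card = (R.filter (fun z => (p - 1 - z.1) + z.2 < a₃)).card := by
    apply Finset.card_nbij' (fun z => (p - 1 - z.1, z.2)) (fun z => (p - 1 - z.1, z.2))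
    all_goals
      rintro ⟨i, j⟩ h
      simp only [tri, R, Finset.coe_filter, Finset.mem_product, Finset.mem_range,
        Set.mem_ofPred_eq, Prod.mk.injEq, and_true, true_and] at h ⊢
      omega
  have t2 : (tri a₂).card = (R.filter (fun z => (p - 1 - z.1) + (q - 1 - z.2) < a₂)).card := by
    apply Finset.card_nbij' (fun z => (p - 1 - z.1, q - 1 - z.2))
      (fun z => (p - 1 - z.1, q - 1 - z.2))
    all_goals
      rintro ⟨i, j⟩ h
      simp only [tri, R, Finset.coe_filter, Finset.mem_product, Finset.mem_range,
        Set.mem_ofPred_eq, Prod.mk.injEq, and_true, true_and] at h ⊢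
      omega
  have t1 : (tri a₁).card = (R.filter (fun z => z.1 + (q - 1 - z.2) < a₁)).card := by
    apply Finset.card_nbij' (fun z => (z.1, q - 1 - z.2)) (fun z => (z.1, q - 1 - z.2))
    all_goals
      rintro ⟨i, j⟩ h
      simp only [tri, R, Finset.coe_filter, Finset.mem_product, Finset.mem_range,
        Set.mem_ofPred_eq, Prod.mk.injEq, and_true, true_and] at h ⊢
      omega
  have hR : R.card = p * q := by simp [R]
  rw [← hR, t1, t2, t3, t4, goodF, Finset.card_filter, Finset.card_filter, Finset.card_filter,
    Finset.card_filter, Finset.card_filter, Finset.card_eq_sum_ones, ← Finset.sum_add_distrib,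
    ← Finset.sum_add_distrib, ← Finset.sum_add_distrib, ← Finset.sum_add_distrib]
  apply Finset.sum_congr rfl
  rintro ⟨i, j⟩ h
  simp only [R, Finset.mem_product, Finset.mem_range] at h ⊢
  obtain ⟨hi, hj⟩ := h
  split_ifs <;> omega

lemma ncard_shift (S : Set (ℤ × ℤ)) (F : Finset (ℕ × ℕ)) (s : ℕ)
    (h : ∀ i j : ℕ, (((i : ℤ) + s, (j : ℤ) + s) ∈ S ↔ (i, j) ∈ F))
    (h' : ∀ z ∈ S, (s : ℤ) ≤ z.1 ∧ (s : ℤ) ≤ z.2) : S.ncard = F.card ∧ S.Finite := by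
  let f : ℕ × ℕ → ℤ × ℤ := fun z => ((z.1 : ℤ) + s, (z.2 : ℤ) + s)
  have hf : Function.Injective f := by
    rintro ⟨a, b⟩ ⟨a', b'⟩ hh
    simp only [f, Prod.mk.injEq] at hh ⊢
    omega
  have e : S = f '' (F : Set (ℕ × ℕ)) := by
    ext ⟨u, v⟩
    constructor
    · intro hz
      obtain ⟨h1, h2⟩ := h' _ hz
      simp only at h1 h2
      obtain ⟨i, rfl⟩ : ∃ i : ℕ, u = i + s := ⟨(u - s).toNat, by omega⟩
      obtain ⟨j, rfl⟩ : ∃ j : ℕ, v = j + s := ⟨(v - s).toNat, by omega⟩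
      exact ⟨(i, j), (h i j).1 hz, rfl⟩
    · rintro ⟨⟨i, j⟩, hz, hzz⟩
      rw [← hzz]
      exact (h i j).2 hz
  rw [e]
  exact ⟨by rw [Set.ncard_image_of_injective _ hf, Set.ncard_coe_finset],
    (Finset.finite_toSet F).image f⟩

lemma mem_octR_int (d m x₁ x₂ x₃ x₄ : ℕ) (z : ℤ × ℤ) :
    latticeEmbed z ∈ octR d m x₁ x₂ x₃ x₄ ↔
    0 ≤ z.1 ∧ z.1 ≤ m ∧ 0 ≤ z.2 ∧ z.2 ≤ d ∧ (x₄ : ℤ) ≤ z.1 + z.2 ∧ z.1 + z.2 ≤ m + d - x₂ ∧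
    z.2 - z.1 ≤ d - x₁ ∧ z.1 - z.2 ≤ m - x₃ := by
  simp only [octR, latticeEmbed, Set.mem_ofPred_eq]
  exact_mod_cast Iff.rfl

lemma mem_int_octR_int (d m x₁ x₂ x₃ x₄ : ℕ) (z : ℤ × ℤ) :
    latticeEmbed z ∈ interior (octR d m x₁ x₂ x₃ x₄) ↔
    0 < z.1 ∧ z.1 < m ∧ 0 < z.2 ∧ z.2 < d ∧ (x₄ : ℤ) < z.1 + z.2 ∧ z.1 + z.2 < m + d - x₂ ∧
    z.2 - z.1 < d - x₁ ∧ z.1 - z.2 < m - x₃ := by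
  rw [int_octR]
  simp only [latticeEmbed]
  exact_mod_cast Iff.rfl

lemma tri_pred (x : ℕ) : 2 * ((tri (x - 1)).card : ℚ) = x * (x - 1) := by
  have := tri_card (x - 1)
  rcases x with _ | n
  · simp [tri]
  · simp only [Nat.add_sub_cancel] at this ⊢
    have h : (2 : ℚ) * (tri n).card = n * (n + 1) := by exact_mod_cast this
    rw [h]; push_cast; ring

lemma tri_q (x : ℕ) : 2 * ((tri x).card : ℚ) = x * (x + 1) := by
  exact_mod_cast tri_card x

/-- For a truncated rectangle `Q` with isosceles corner cuts,
`g + r(Q) − 3 = U(g, d) + 2 + Σᵢ xᵢ(xᵢ − d)/(d − 1)`. -/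
theorem stmt15 (d m x₁ x₂ x₃ x₄ : ℕ) (hd : 2 ≤ d) (hm : 1 ≤ m)
    (hx12 : x₁ + x₂ < m) (hx34 : x₃ + x₄ < m)
    (hx14 : x₁ + x₄ < d) (hx23 : x₂ + x₃ < d) :
    (polygonGenus (truncRectIso d m x₁ x₂ x₃ x₄) : ℚ) +
        (boundaryLatticeCount (truncRectIso d m x₁ x₂ x₃ x₄) : ℚ) - 3 =
      ((polygonGenus (truncRectIso d m x₁ x₂ x₃ x₄) : ℚ) +
          2 * (polygonGenus (truncRectIso d m x₁ x₂ x₃ x₄) : ℚ) / ((d : ℚ) - 1) +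
          2 * (d : ℚ) - 3) + 2 +
        ((x₁ : ℚ) * ((x₁ : ℚ) - (d : ℚ)) / ((d : ℚ) - 1) +
          (x₂ : ℚ) * ((x₂ : ℚ) - (d : ℚ)) / ((d : ℚ) - 1) +
          (x₃ : ℚ) * ((x₃ : ℚ) - (d : ℚ)) / ((d : ℚ) - 1) +
          (x₄ : ℚ) * ((x₄ : ℚ) - (d : ℚ)) / ((d : ℚ) - 1)) := by
  rw [hull_eq d m x₁ x₂ x₃ x₄ hx12 hx34 hx14 hx23]
  set Q := octR d m x₁ x₂ x₃ x₄ with hQ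
  obtain ⟨gi, fi⟩ := ncard_shift (interiorLatticePoints Q)
    (goodF (m - 1) (d - 1) (x₁ - 1) (x₂ - 1) (x₃ - 1) (x₄ - 1)) 1
    (by
      intro i j
      simp only [interiorLatticePoints, Set.mem_ofPred_eq, hQ, mem_int_octR_int, goodF,
        Finset.mem_filter, Finset.mem_product, Finset.mem_range]
      omega)
    (by
      intro z hz
      simp only [interiorLatticePoints, Set.mem_ofPred_eq, hQ, mem_int_octR_int] at hz
      omega)
  obtain ⟨gt, ft⟩ := ncard_shift {z : ℤ × ℤ | latticeEmbed z ∈ Q}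
    (goodF (m + 1) (d + 1) x₁ x₂ x₃ x₄) 0
    (by
      intro i j
      simp only [Set.mem_ofPred_eq, hQ, mem_octR_int, goodF,
        Finset.mem_filter, Finset.mem_product, Finset.mem_range]
      omega)
    (by
      intro z hz
      simp only [Set.mem_ofPred_eq, hQ, mem_octR_int] at hz
      omega)
  have hb : boundaryLatticeCount Q + (interiorLatticePoints Q).ncard =
      {z : ℤ × ℤ | latticeEmbed z ∈ Q}.ncard := by
    have : {p : ℤ × ℤ | latticeEmbed p ∈ frontier Q} =
        {z : ℤ × ℤ | latticeEmbed z ∈ Q} \ interiorLatticePoints Q := by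
      ext z
      rw [(closed_octR _ _ _ _ _ _).frontier_eq]
      rfl
    rw [boundaryLatticeCount, this]
    exact Set.ncard_sdiff_add_ncard_of_subset (fun z hz => (interior_subset (s := Q) hz : latticeEmbed z ∈ Q)) ft
  have c1 := goodF_card (m - 1) (d - 1) (x₁ - 1) (x₂ - 1) (x₃ - 1) (x₄ - 1) (by omega) (by omega)
    (by omega) (by omega) (by omega) (by omega)
  have c2 := goodF_card (m + 1) (d + 1) x₁ x₂ x₃ x₄ (by omega) (by omega)
    (by omega) (by omega) (by omega) (by omega)
  rw [← gi] at c1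
  rw [← gt, ← hb] at c2
  change (interiorLatticePoints Q).ncard + _ + _ + _ + _ = _ at c1
  simp only [polygonGenus]
  generalize (interiorLatticePoints Q).ncard = g at *
  generalize boundaryLatticeCount Q = r at *
  have c1q : (g : ℚ) + (tri (x₁ - 1)).card + (tri (x₂ - 1)).card + (tri (x₃ - 1)).card
      + (tri (x₄ - 1)).card = (m - 1) * (d - 1) := by
    have a1 : ((m - 1 : ℕ) : ℚ) = m - 1 := by push_cast [hm]; ring
    have a2 : ((d - 1 : ℕ) : ℚ) = d - 1 := by
      push_cast [(by omega : 1 ≤ d)]; ring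
    rw [← a1, ← a2]
    exact_mod_cast c1
  have c2q : (r : ℚ) + g + (tri x₁).card + (tri x₂).card + (tri x₃).card
      + (tri x₄).card = (m + 1) * (d + 1) := by exact_mod_cast c2
  have hd' : (d : ℚ) - 1 ≠ 0 := by
    have : (2 : ℚ) ≤ d := by exact_mod_cast hd
    intro h; linarith
  have e1 : 2 * (g : ℚ) = 2 * (m - 1) * (d - 1) - (x₁ * (x₁ - 1) + x₂ * (x₂ - 1)
      + x₃ * (x₃ - 1) + x₄ * (x₄ - 1)) := by
    linarith [tri_pred x₁, tri_pred x₂, tri_pred x₃, tri_pred x₄]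
  have e2 : (r : ℚ) = 2 * m + 2 * d - (x₁ + x₂ + x₃ + x₄) := by
    linarith [tri_q x₁, tri_q x₂, tri_q x₃, tri_q x₄]
  rw [e2, e1]
  field_simp
  ring
end

section
/- Let g ≥ 7 be an integer with g ≡ 1 (mod 3), let m = (g + 5)/3, and let P = conv{(2, 0), (m, 0), (m, 2), (m − 2, 4), (0, 4), (0, 2)} ⊆ ℝ² (the m × 4 rectangle with triangles of legs (2, 2) removed from the two antipodal corners (0, 0) and (m, 4)). Then P is a maximal lattice polygon with exactly g interior lattice points, lattice width 4, expected gonality 4, no column vectors, and g + r(P) − 3 = (5g + 13)/3. -/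
open Set

/-- The `m × 4` rectangle with triangles of legs `(2, 2)` removed from the antipodal
corners `(0, 0)` and `(m, 4)`. -/
def P17 (m : ℕ) : Set (ℝ × ℝ) :=
  convexHull ℝ {((2 : ℝ), (0 : ℝ)), ((m : ℝ), (0 : ℝ)), ((m : ℝ), (2 : ℝ)),
    ((m : ℝ) - 2, (4 : ℝ)), ((0 : ℝ), (4 : ℝ)), ((0 : ℝ), (2 : ℝ))}

lemma aux_mem_P17 (m : ℕ) (hm : 4 ≤ m) (p : ℝ × ℝ) :
    p ∈ P17 m ↔ 0 ≤ p.1 ∧ p.1 ≤ m ∧ 0 ≤ p.2 ∧ p.2 ≤ 4 ∧ 2 ≤ p.1 + p.2 ∧ p.1 + p.2 ≤ m + 2 := by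
  have hm' : (4 : ℝ) ≤ m := by exact_mod_cast hm
  constructor
  · intro h
    have hc : Convex ℝ {p : ℝ × ℝ | 0 ≤ p.1 ∧ p.1 ≤ m ∧ 0 ≤ p.2 ∧ p.2 ≤ 4 ∧ 2 ≤ p.1 + p.2 ∧
        p.1 + p.2 ≤ m + 2} := by
      rintro ⟨x, y⟩ hx ⟨z, w⟩ hz a b ha hb hab
      simp only [mem_ofPred_eq, Prod.smul_mk, Prod.mk_add_mk, smul_eq_mul] at *
      obtain ⟨h1, h2, h3, h4, h5, h6⟩ := hx
      obtain ⟨k1, k2, k3, k4, k5, k6⟩ := hz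
      obtain rfl : b = 1 - a := by linarith
      refine ⟨?_, ?_, ?_, ?_, ?_, ?_⟩ <;> nlinarith
    refine convexHull_min ?_ hc h
    intro q hq
    simp only [mem_insert_iff, mem_singleton_iff] at hq
    rcases hq with rfl | rfl | rfl | rfl | rfl | rfl <;> 
      refine ⟨?_, ?_, ?_, ?_, ?_, ?_⟩ <;> simp <;> linarith
  · rintro ⟨h1, h2, h3, h4, h5, h6⟩
    have hconv : Convex ℝ (P17 m) := convex_convexHull ℝ _
    have key : ∀ u v : ℝ × ℝ, u ∈ P17 m → v ∈ P17 m → ∀ t : ℝ, 0 ≤ t → t ≤ 1 → ∀ w : ℝ × ℝ,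
        w.1 = (1 - t) * u.1 + t * v.1 → w.2 = (1 - t) * u.2 + t * v.2 → w ∈ P17 m := by
      intro u v hu hv t ht ht1 w hw1 hw2
      have := hconv hu hv (sub_nonneg.2 ht1) ht (by ring)
      convert this using 1
      ext <;> simp [hw1, hw2]
    have v1 : ((2 : ℝ), (0 : ℝ)) ∈ P17 m := subset_convexHull ℝ _ (by simp)
    have v2 : ((m : ℝ), (0 : ℝ)) ∈ P17 m := subset_convexHull ℝ _ (by simp)
    have v3 : ((m : ℝ), (2 : ℝ)) ∈ P17 m := subset_convexHull ℝ _ (by simp)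
    have v4 : ((m : ℝ) - 2, (4 : ℝ)) ∈ P17 m := subset_convexHull ℝ _ (by simp)
    have v5 : ((0 : ℝ), (4 : ℝ)) ∈ P17 m := subset_convexHull ℝ _ (by simp)
    have v6 : ((0 : ℝ), (2 : ℝ)) ∈ P17 m := subset_convexHull ℝ _ (by simp)
    have row : ∀ l r : ℝ, (l, p.2) ∈ P17 m → (r, p.2) ∈ P17 m → l ≤ p.1 → p.1 ≤ r → l < r →
        p ∈ P17 m := by
      intro l r hl hr hlp hpr hlr
      have hpos : 0 < r - l := by linarith
      refine key _ _ hl hr ((p.1 - l) / (r - l)) (div_nonneg (by linarith) hpos.le)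
        ((div_le_one hpos).2 (by linarith)) p ?_ ?_
      · field_simp
        ring
      · simp only
        ring
    rcases le_total p.2 2 with hy | hy
    · refine row (2 - p.2) m ?_ ?_ (by linarith) h2 (by linarith)
      · refine key _ _ v1 v6 (p.2 / 2) (by linarith) (by linarith) _ ?_ ?_ <;> simp only <;> ring
      · refine key _ _ v2 v3 (p.2 / 2) (by linarith) (by linarith) _ ?_ ?_ <;> simp only <;> ring
    · refine row 0 (m + 2 - p.2) ?_ ?_ h1 (by linarith) (by linarith)
      · refine key _ _ v6 v5 ((p.2 - 2) / 2) (by linarith) (by linarith) _ ?_ ?_ <;>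
          simp only <;> ring
      · refine key _ _ v3 v4 ((p.2 - 2) / 2) (by linarith) (by linarith) _ ?_ ?_ <;>
          simp only <;> ring

lemma aux_mem_int (m : ℕ) (hm : 4 ≤ m) (p : ℝ × ℝ) :
    p ∈ interior (P17 m) ↔
      0 < p.1 ∧ p.1 < m ∧ 0 < p.2 ∧ p.2 < 4 ∧ 2 < p.1 + p.2 ∧ p.1 + p.2 < m + 2 := by
  constructor
  · intro h
    obtain ⟨ε, hε, hb⟩ := Metric.isOpen_iff.1 isOpen_interior p h
    have key : ∀ a b : ℝ, |a| < ε → |b| < ε → (p.1 + a, p.2 + b) ∈ P17 m := by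
      intro a b ha hb'
      apply interior_subset
      apply hb
      rw [Metric.mem_ball, Prod.dist_eq]
      simp [Real.dist_eq, ha, hb']
    have e1 : |ε / 2| < ε := by rw [abs_of_pos] <;> linarith
    have e2 : |-(ε / 2)| < ε := by rw [abs_neg]; exact e1
    have e0 : |(0 : ℝ)| < ε := by simpa using hε
    have k1 := (aux_mem_P17 m hm _).1 (key _ _ e1 e0)
    have k2 := (aux_mem_P17 m hm _).1 (key _ _ e2 e0)
    have k3 := (aux_mem_P17 m hm _).1 (key _ _ e0 e1)
    have k4 := (aux_mem_P17 m hm _).1 (key _ _ e0 e2)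
    simp only at k1 k2 k3 k4
    refine ⟨?_, ?_, ?_, ?_, ?_, ?_⟩ <;> linarith
  · intro h
    have ho : IsOpen {p : ℝ × ℝ | 0 < p.1 ∧ p.1 < m ∧ 0 < p.2 ∧ p.2 < 4 ∧ 2 < p.1 + p.2 ∧
        p.1 + p.2 < m + 2} := by
      refine IsOpen.and ?_ (IsOpen.and ?_ (IsOpen.and ?_ (IsOpen.and ?_ (IsOpen.and ?_ ?_)))) <;>
        exact isOpen_lt (by fun_prop) (by fun_prop)
    refine interior_maximal ?_ ho h
    rintro q ⟨h1, h2, h3, h4, h5, h6⟩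
    exact (aux_mem_P17 m hm q).2 ⟨h1.le, h2.le, h3.le, h4.le, h5.le, h6.le⟩

lemma aux_lat_mem (m : ℕ) (hm : 4 ≤ m) (p : ℤ × ℤ) :
    latticeEmbed p ∈ P17 m ↔
      0 ≤ p.1 ∧ p.1 ≤ m ∧ 0 ≤ p.2 ∧ p.2 ≤ 4 ∧ 2 ≤ p.1 + p.2 ∧ p.1 + p.2 ≤ m + 2 := by
  rw [aux_mem_P17 m hm]
  simp only [latticeEmbed]
  norm_cast

lemma aux_lat_int (m : ℕ) (hm : 4 ≤ m) (p : ℤ × ℤ) :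
    latticeEmbed p ∈ interior (P17 m) ↔
      0 < p.1 ∧ p.1 < m ∧ 0 < p.2 ∧ p.2 < 4 ∧ 2 < p.1 + p.2 ∧ p.1 + p.2 < m + 2 := by
  rw [aux_mem_int m hm]
  simp only [latticeEmbed]
  norm_cast

lemma aux_genus (m : ℕ) (hm : 4 ≤ m) : polygonGenus (P17 m) = 3 * m - 5 := by
  have : interiorLatticePoints (P17 m) =
      ((Finset.Icc 2 (m - 1 : ℤ) ×ˢ {1} ∪ (Finset.Icc 1 (m - 1 : ℤ) ×ˢ {2} ∪
        Finset.Icc 1 (m - 2 : ℤ) ×ˢ {3}) : Finset (ℤ × ℤ)) : Set (ℤ × ℤ)) := by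
    ext ⟨a, b⟩
    simp only [interiorLatticePoints, mem_ofPred_eq, aux_lat_int m hm, Finset.coe_union,
      Finset.coe_product, mem_union, mem_prod, Finset.mem_coe, Finset.mem_Icc,
      Finset.mem_singleton]
    omega
  rw [polygonGenus, this, Set.ncard_coe_finset, Finset.card_union_of_disjoint,
    Finset.card_union_of_disjoint]
  · simp only [Finset.card_product, Int.card_Icc, Finset.card_singleton]
    omega
  all_goals
    rw [Finset.disjoint_left]
    rintro ⟨a, b⟩ h
    simp only [Finset.mem_union, Finset.mem_product, Finset.mem_Icc, Finset.mem_singleton] at h ⊢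
    omega

lemma aux_closed (m : ℕ) (hm : 4 ≤ m) : IsClosed (P17 m) := by
  have : P17 m = {p : ℝ × ℝ | 0 ≤ p.1 ∧ p.1 ≤ m ∧ 0 ≤ p.2 ∧ p.2 ≤ 4 ∧ 2 ≤ p.1 + p.2 ∧
        p.1 + p.2 ≤ m + 2} := by
    ext p
    exact aux_mem_P17 m hm p
  rw [this]
  refine IsClosed.and ?_ (IsClosed.and ?_ (IsClosed.and ?_ (IsClosed.and ?_
    (IsClosed.and ?_ ?_)))) <;>
    exact isClosed_le (by fun_prop) (by fun_prop)

lemma aux_bdry (m : ℕ) (hm : 4 ≤ m) : boundaryLatticeCount (P17 m) = 2 * m + 4 := by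
  have : {p : ℤ × ℤ | latticeEmbed p ∈ frontier (P17 m)} =
      ((Finset.Icc 2 (m : ℤ) ×ˢ {0} ∪ (Finset.Icc 0 (m - 2 : ℤ) ×ˢ {4} ∪
        ({((1 : ℤ), (1 : ℤ)), ((m : ℤ), 1), (0, 2), ((m : ℤ), 2), (0, 3), ((m : ℤ) - 1, 3)}
          : Finset (ℤ × ℤ))) : Finset (ℤ × ℤ)) : Set (ℤ × ℤ)) := by
    ext ⟨a, b⟩
    simp only [(aux_closed m hm).frontier_eq, mem_sdiff,
      mem_ofPred_eq, aux_lat_int m hm, aux_lat_mem m hm,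
      Finset.mem_union, Finset.mem_product,
      Finset.mem_coe, Finset.mem_Icc,
      Finset.mem_singleton, Finset.mem_insert, Prod.mk.injEq]
    omega
  rw [boundaryLatticeCount, this, Set.ncard_coe_finset, Finset.card_union_of_disjoint,
    Finset.card_union_of_disjoint]
  · have h6 : ({((1 : ℤ), (1 : ℤ)), ((m : ℤ), 1), (0, 2), ((m : ℤ), 2), (0, 3), ((m : ℤ) - 1, 3)}
          : Finset (ℤ × ℤ)).card = 6 := by
      repeat rw [Finset.card_insert_of_notMem]
      · simp
      all_goals
        simp only [Finset.mem_insert, Finset.mem_singleton, Prod.mk.injEq]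
        omega
    rw [h6]
    simp only [Finset.card_product, Int.card_Icc, Finset.card_singleton]
    omega
  all_goals
    rw [Finset.disjoint_left]
    rintro ⟨a, b⟩ h
    simp only [Finset.mem_union, Finset.mem_product, Finset.mem_Icc, Finset.mem_singleton,
      Finset.mem_insert, Prod.mk.injEq] at h ⊢
    omega

lemma aux_lw_lower (Q : Set (ℝ × ℝ)) (a b c d : ℤ × ℤ) (w : ℕ)
    (ha : latticeEmbed a ∈ Q) (hb : latticeEmbed b ∈ Q) (hc : latticeEmbed c ∈ Q)
    (hd : latticeEmbed d ∈ Q) (hab : a.2 = b.2) (hab' : a.1 + w ≤ b.1)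
    (hcd : c.1 = d.1) (hcd' : c.2 + w ≤ d.2) (s : ℕ) (φ : ℝ × ℝ → ℝ × ℝ) (hφ : IsZAffine φ)
    (hs : φ '' Q ⊆ strip (s : ℝ)) : w ≤ s := by
  obtain ⟨A, B, C, D, E, F, hdet, hφ⟩ := hφ
  have key : ∀ p : ℤ × ℤ, latticeEmbed p ∈ Q → 0 ≤ C * p.1 + D * p.2 + F ∧
      C * p.1 + D * p.2 + F ≤ s := by
    intro p hp
    have := hs ⟨_, hp, rfl⟩
    rw [hφ] at this
    simp only [strip, latticeEmbed, mem_ofPred_eq] at this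
    exact_mod_cast this
  have ka := key a ha
  have kb := key b hb
  have kc := key c hc
  have kd := key d hd
  rw [hab] at ka
  rw [hcd] at kc
  zify
  have hw : (0 : ℤ) ≤ w := by positivity
  rcases lt_trichotomy C 0 with h | h | h
  · nlinarith
  · subst h
    rcases lt_trichotomy D 0 with h | h | h
    · nlinarith
    · subst h
      simp at hdet
    · nlinarith
  · nlinarith

lemma aux_lw (m : ℕ) (hm : 4 ≤ m) : LatticeWidthIs (P17 m) 4 := by
  constructor
  · refine ⟨by norm_num, id, ⟨1, 0, 0, 1, 0, 0, by norm_num, by intro p; simp⟩, ?_⟩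
    rintro _ ⟨p, hp, rfl⟩
    have := (aux_mem_P17 m hm p).1 hp
    simp only [strip, mem_ofPred_eq, id]
    push_cast
    exact ⟨this.2.2.1, this.2.2.2.1⟩
  · rintro s ⟨hs, φ, hφ, h⟩
    refine aux_lw_lower (P17 m) (0, 2) (m, 2) (2, 0) (2, 4) 4 ?_ ?_ ?_ ?_ rfl ?_ rfl ?_ s φ hφ h
    iterate 4 exact (aux_lat_mem m hm _).2 (by simp only; omega)
    all_goals push_cast
    all_goals omega

lemma aux_lw_int (m : ℕ) (hm : 4 ≤ m) : LatticeWidthIs (interiorPolygon (P17 m)) 2 := by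
  constructor
  · refine ⟨by norm_num, fun p => (p.1, p.2 - 1), ⟨1, 0, 0, 1, 0, -1, by norm_num, by
      intro p; ext <;> simp; ring⟩, ?_⟩
    rintro _ ⟨p, hp, rfl⟩
    have hc : Convex ℝ {p : ℝ × ℝ | 1 ≤ p.2 ∧ p.2 ≤ 3} := by
      rintro ⟨x, y⟩ hx ⟨z, w⟩ hz a b ha hb hab
      simp only [mem_ofPred_eq, Prod.smul_mk, Prod.mk_add_mk, smul_eq_mul] at *
      obtain rfl : b = 1 - a := by linarith
      constructor <;> nlinarith
    have : p ∈ {p : ℝ × ℝ | 1 ≤ p.2 ∧ p.2 ≤ 3} := by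
      refine convexHull_min ?_ hc hp
      rintro _ ⟨q, hq, rfl⟩
      have h := (aux_lat_int m hm q).1 hq
      have h1 : 1 ≤ q.2 := by omega
      have h2 : q.2 ≤ 3 := by omega
      simp only [latticeEmbed, mem_ofPred_eq]
      exact ⟨by exact_mod_cast h1, by exact_mod_cast h2⟩
    simp only [strip, mem_ofPred_eq] at this ⊢
    push_cast
    constructor <;> linarith
  · rintro s ⟨hs, φ, hφ, h⟩
    have key : ∀ p : ℤ × ℤ, latticeEmbed p ∈ interior (P17 m) →
        latticeEmbed p ∈ interiorPolygon (P17 m) := fun p hp =>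
      subset_convexHull ℝ _ ⟨p, hp, rfl⟩
    refine aux_lw_lower _ (1, 2) (m - 1, 2) (2, 1) (2, 3) 2 (key _ ?_) (key _ ?_)
      (key _ ?_) (key _ ?_) rfl ?_ rfl ?_ s φ hφ h
    iterate 4 exact (aux_lat_int m hm _).2 (by simp only; omega)
    all_goals push_cast
    all_goals omega

lemma aux_not_equiv (m : ℕ) (hm : 4 ≤ m) : ¬ EquivPolygon (P17 m) twoUpsilon := by
  rintro ⟨φ, ⟨A, B, C, D, E, F, -, hφ⟩, h⟩
  have hsub : ∀ p ∈ twoUpsilon, p.1 + p.2 ≤ 2 ∧ p.1 - 2 * p.2 ≤ 2 ∧ p.2 - 2 * p.1 ≤ 2 := by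
    intro p hp
    have hc : Convex ℝ {p : ℝ × ℝ | p.1 + p.2 ≤ 2 ∧ p.1 - 2 * p.2 ≤ 2 ∧ p.2 - 2 * p.1 ≤ 2} := by
      rintro ⟨x, y⟩ hx ⟨z, w⟩ hz a b ha hb hab
      simp only [mem_ofPred_eq, Prod.smul_mk, Prod.mk_add_mk, smul_eq_mul] at *
      obtain rfl : b = 1 - a := by linarith
      refine ⟨?_, ?_, ?_⟩ <;> nlinarith
    refine convexHull_min ?_ hc hp
    intro q hq
    simp only [mem_insert_iff, mem_singleton_iff] at hq
    rcases hq with rfl | rfl | rfl <;> norm_num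
  have hrefl : ∀ p ∈ twoUpsilon, (A * m + B * 4 + 2 * E - p.1, C * m + D * 4 + 2 * F - p.2) ∈
      twoUpsilon := by
    intro p hp
    rw [← h] at hp ⊢
    obtain ⟨q, hq, rfl⟩ := hp
    have hq' := (aux_mem_P17 m hm q).1 hq
    refine ⟨(m - q.1, 4 - q.2), (aux_mem_P17 m hm _).2 ?_, ?_⟩
    · simp only
      refine ⟨?_, ?_, ?_, ?_, ?_, ?_⟩ <;> linarith
    · rw [hφ, hφ]
      ext <;> simp only <;> ring
  have h1 := (hsub _ (hrefl (-2, -2) (subset_convexHull ℝ _ (by simp)))).1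
  have h2 := (hsub _ (hrefl (0, 2) (subset_convexHull ℝ _ (by simp)))).2.1
  have h3 := (hsub _ (hrefl (2, 0) (subset_convexHull ℝ _ (by simp)))).2.2
  simp only at h1 h2 h3
  linarith

lemma aux_collinear (τ : Set (ℝ × ℝ)) (h : Module.finrank ℝ (vectorSpan ℝ τ) = 1)
    (p q r : ℤ × ℤ) (hp : latticeEmbed p ∈ τ) (hq : latticeEmbed q ∈ τ)
    (hr : latticeEmbed r ∈ τ) :
    (q.1 - p.1) * (r.2 - p.2) = (q.2 - p.2) * (r.1 - p.1) := by
  have hc : Collinear ℝ τ := collinear_iff_finrank_le_one.2 h.le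
  obtain ⟨v, hv⟩ := (collinear_iff_of_mem hp).1 hc
  obtain ⟨s, hs⟩ := hv _ hq
  obtain ⟨t, ht⟩ := hv _ hr
  simp only [latticeEmbed, vadd_eq_add, Prod.ext_iff, Prod.fst_add, Prod.snd_add, Prod.smul_fst,
    Prod.smul_snd, smul_eq_mul] at hs ht
  have : ((q.1 : ℝ) - p.1) * (r.2 - p.2) = (q.2 - p.2) * (r.1 - p.1) := by
    rw [hs.1, hs.2, ht.1, ht.2]
    ring
  exact_mod_cast this

lemma aux_column (m : ℕ) (hm : 4 ≤ m) (v : ℤ × ℤ) : ¬ IsColumnVector (P17 m) v := by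
  rintro ⟨hv, τ, ⟨-, hdim⟩, h⟩
  obtain ⟨a, b⟩ := v
  have key : ∀ x y : ℤ, (0 ≤ x ∧ x ≤ m ∧ 0 ≤ y ∧ y ≤ 4 ∧ 2 ≤ x + y ∧ x + y ≤ m + 2) →
      ¬ (0 ≤ x + a ∧ x + a ≤ m ∧ 0 ≤ y + b ∧ y + b ≤ 4 ∧ 2 ≤ x + a + (y + b) ∧
        x + a + (y + b) ≤ m + 2) → latticeEmbed (x, y) ∈ τ := by
    intro x y hxy hn
    by_contra hτ
    exact hn ((aux_lat_mem m hm _).1 (h (x, y) ⟨(aux_lat_mem m hm _).2 hxy, hτ⟩))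
  have hab : ¬ (a = 0 ∧ b = 0) := by
    rintro ⟨rfl, rfl⟩
    exact hv rfl
  have col := fun x y z => aux_collinear τ hdim x y z
  have c1 : 0 < a → latticeEmbed (m, 0) ∈ τ ∧ latticeEmbed (m, 2) ∈ τ := fun _ =>
    ⟨key _ _ (by omega) (by omega), key _ _ (by omega) (by omega)⟩
  have c2 : a < 0 → latticeEmbed (0, 2) ∈ τ ∧ latticeEmbed (0, 4) ∈ τ := fun _ =>
    ⟨key _ _ (by omega) (by omega), key _ _ (by omega) (by omega)⟩
  have c3 : 0 < b → latticeEmbed (0, 4) ∈ τ ∧ latticeEmbed (m - 2, 4) ∈ τ := fun _ =>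
    ⟨key _ _ (by omega) (by omega), key _ _ (by omega) (by omega)⟩
  have c4 : b < 0 → latticeEmbed (2, 0) ∈ τ ∧ latticeEmbed (m, 0) ∈ τ := fun _ =>
    ⟨key _ _ (by omega) (by omega), key _ _ (by omega) (by omega)⟩
  have c5 : 0 < a + b → latticeEmbed (m, 2) ∈ τ ∧ latticeEmbed (m - 2, 4) ∈ τ := fun _ =>
    ⟨key _ _ (by omega) (by omega), key _ _ (by omega) (by omega)⟩
  have c6 : a + b < 0 → latticeEmbed (2, 0) ∈ τ ∧ latticeEmbed (0, 2) ∈ τ := fun _ =>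
    ⟨key _ _ (by omega) (by omega), key _ _ (by omega) (by omega)⟩
  rcases lt_trichotomy a 0 with ha | ha | ha
  · obtain ⟨k1, k2⟩ := c2 ha
    rcases lt_or_ge 0 b with hb | hb
    · have := col _ _ _ k1 k2 (c3 hb).2
      simp only at this
      omega
    · have := col _ _ _ k1 k2 (c6 (by omega)).1
      simp at this
  · rcases lt_or_ge 0 b with hb | hb
    · obtain ⟨k1, k2⟩ := c3 hb
      have := col _ _ _ k1 k2 (c5 (by omega)).1
      simp only at this
      omega
    · obtain ⟨k1, k2⟩ := c4 (by omega)
      have := col _ _ _ k1 k2 (c6 (by omega)).2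
      simp only at this
      omega
  · obtain ⟨k1, k2⟩ := c1 ha
    rcases lt_or_ge b 0 with hb | hb
    · have := col _ _ _ k1 k2 (c4 hb).1
      simp only at this
      omega
    · have := col _ _ _ k1 k2 (c5 (by omega)).2
      simp only at this
      omega

lemma aux_beyond (Q P : Set (ℝ × ℝ)) (hQ : Convex ℝ Q) (hPQ : P ⊆ Q) (e q : ℝ × ℝ) (hq : q ∈ Q)
    (α β : ℝ) (hlt : α * e.1 + β * e.2 < α * q.1 + β * q.2)
    (hP : ∀ z : ℝ × ℝ, e.1 - 1 < z.1 → z.1 < e.1 + 1 → e.2 - 1 < z.2 → z.2 < e.2 + 1 →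
      α * z.1 + β * z.2 < α * e.1 + β * e.2 → z ∈ interior P) : e ∈ interior Q := by
  set M := |e.1 - q.1| + |e.2 - q.2| + 1 with hM
  have hM0 : 0 < M := by positivity
  have a1 := abs_nonneg (e.1 - q.1)
  have a2 := abs_nonneg (e.2 - q.2)
  have hb1 : |(e.1 - q.1) / M| < 1 := by
    rw [abs_div, abs_of_pos hM0, div_lt_one hM0]; linarith
  have hb2 : |(e.2 - q.2) / M| < 1 := by
    rw [abs_div, abs_of_pos hM0, div_lt_one hM0]; linarith
  rw [abs_lt] at hb1 hb2
  have hz : (e.1 + (e.1 - q.1) / M, e.2 + (e.2 - q.2) / M) ∈ interior P := by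
    apply hP <;> simp only
    · linarith
    · linarith
    · linarith
    · linarith
    · have : (α * (e.1 - q.1) + β * (e.2 - q.2)) / M < 0 :=
        div_neg_of_neg_of_pos (by linarith) hM0
      have h2 : (α * (e.1 - q.1) + β * (e.2 - q.2)) / M =
        α * ((e.1 - q.1) / M) + β * ((e.2 - q.2) / M) := by ring
      linarith
  refine hQ.openSegment_interior_self_subset_interior (interior_mono hPQ hz) hq ?_
  refine ⟨M / (M + 1), 1 / (M + 1), by positivity, by positivity, by field_simp, ?_⟩
  ext <;> simp <;> field_simp <;> ring

lemma aux_max (m : ℕ) (hm : 4 ≤ m) : IsMaximalPolygon (P17 m) := by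
  have hm' : (4 : ℝ) ≤ m := by exact_mod_cast hm
  constructor
  · refine ⟨{(2, 0), ((m : ℤ), 0), ((m : ℤ), 2), ((m : ℤ) - 2, 4), (0, 4), (0, 2)}, by simp, ?_⟩
    simp [P17, latticeEmbed, Set.image_insert_eq]
  · rintro Q ⟨S, hS, rfl⟩ hPQ hint
    refine Subset.antisymm ?_ hPQ
    refine convexHull_min ?_ (convex_convexHull ℝ _)
    rintro _ ⟨q, hq, rfl⟩
    have hqQ := subset_convexHull ℝ _ (Set.mem_image_of_mem latticeEmbed hq)
    have key : ∀ (e : ℤ × ℤ) (α β : ℤ), ¬ (0 < e.1 ∧ e.1 < m ∧ 0 < e.2 ∧ e.2 < 4 ∧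
        2 < e.1 + e.2 ∧ e.1 + e.2 < m + 2) →
        (∀ x y : ℝ, (e.1 : ℝ) - 1 < x → x < e.1 + 1 → (e.2 : ℝ) - 1 < y → y < e.2 + 1 →
          α * x + β * y < α * e.1 + β * e.2 →
          0 < x ∧ x < m ∧ 0 < y ∧ y < 4 ∧ 2 < x + y ∧ x + y < m + 2) →
        α * q.1 + β * q.2 ≤ α * e.1 + β * e.2 := by
      intro e α β he hP
      by_contra! hlt
      apply he
      rw [← aux_lat_int m hm]
      change e ∈ interiorLatticePoints (P17 m)
      rw [← hint]
      refine aux_beyond _ _ (convex_convexHull ℝ _) hPQ _ _ hqQ α β ?_ ?_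
      · simp only [latticeEmbed]
        exact_mod_cast hlt
      · intro z h1 h2 h3 h4 h5
        exact (aux_mem_int m hm z).2 (hP z.1 z.2 h1 h2 h3 h4 h5)
    rw [aux_lat_mem m hm]
    have k1 := key (0, 3) (-1) 0 (by simp) (by
      intro x y; push_cast; intros; refine ⟨?_, ?_, ?_, ?_, ?_, ?_⟩ <;> linarith)
    have k2 := key (m, 1) 1 0 (by simp) (by
      intro x y; push_cast; intros; refine ⟨?_, ?_, ?_, ?_, ?_, ?_⟩ <;> linarith)
    have k3 := key (m - 1, 0) 0 (-1) (by simp) (by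
      intro x y; push_cast; intros; refine ⟨?_, ?_, ?_, ?_, ?_, ?_⟩ <;> linarith)
    have k4 := key (1, 4) 0 1 (by simp) (by
      intro x y; push_cast; intros; refine ⟨?_, ?_, ?_, ?_, ?_, ?_⟩ <;> linarith)
    have k5 := key (1, 1) (-1) (-1) (by simp) (by
      intro x y; push_cast; intros; refine ⟨?_, ?_, ?_, ?_, ?_, ?_⟩ <;> linarith)
    have k6 := key (m - 1, 3) 1 1 (by simp only; omega) (by
      intro x y; push_cast; intros; refine ⟨?_, ?_, ?_, ?_, ?_, ?_⟩ <;> linarith)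
    simp only at k1 k2 k3 k4 k5 k6
    omega

/-- For `g ≥ 7` with `g ≡ 1 (mod 3)` and `m = (g + 5)/3`, the polygon `P17 m` is a
maximal lattice polygon of genus `g`, lattice width `4`, expected gonality `4`, has no
column vectors, and satisfies `g + r(P) − 3 = (5g + 13)/3`. -/
theorem stmt17 (g : ℕ) (hg : 7 ≤ g) (hmod : g % 3 = 1) :
    IsMaximalPolygon (P17 ((g + 5) / 3)) ∧
    polygonGenus (P17 ((g + 5) / 3)) = g ∧
    LatticeWidthIs (P17 ((g + 5) / 3)) 4 ∧
    ExpectedGonalityIs (P17 ((g + 5) / 3)) 4 ∧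
    (∀ v : ℤ × ℤ, ¬ IsColumnVector (P17 ((g + 5) / 3)) v) ∧
    (g : ℚ) + (boundaryLatticeCount (P17 ((g + 5) / 3)) : ℚ) - 3 =
      (5 * (g : ℚ) + 13) / 3 := by
  have hm : 4 ≤ (g + 5) / 3 := by omega
  have hg3 : g + 5 = 3 * ((g + 5) / 3) := by omega
  generalize (g + 5) / 3 = m at hm hg3 ⊢
  refine ⟨aux_max m hm, ?_, aux_lw m hm, Or.inr ⟨aux_not_equiv m hm, 2, aux_lw_int m hm, rfl⟩,
    aux_column m hm, ?_⟩
  · rw [aux_genus m hm]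
    omega
  · rw [aux_bdry m hm]
    have : (g : ℚ) + 5 = 3 * m := by exact_mod_cast hg3
    push_cast
    linarith
end

section
/- Let g ≥ 12 be an integer with g ≡ 0 (mod 4), let m = g/4 + 2, and let P = conv{(3, 0), (m, 0), (m, 3), (m − 2, 5), (0, 5), (0, 3)} ⊆ ℝ² (the m × 5 rectangle with a triangle of legs (3, 3) removed at corner (0, 0) and a triangle of legs (2, 2) removed at the antipodal corner (m, 5)). Then P is a maximal lattice polygon with exactly g interior lattice points, lattice width 5, expected gonality 5, no column vectors, and g + r(P) − 3 = 3g/2 + 6. -/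
open Set

/-- The `m × 5` rectangle with a triangle of legs `(3, 3)` removed at corner `(0, 0)`
and a triangle of legs `(2, 2)` removed at the antipodal corner `(m, 5)`. -/
def P18 (m : ℕ) : Set (ℝ × ℝ) :=
  convexHull ℝ {((3 : ℝ), (0 : ℝ)), ((m : ℝ), (0 : ℝ)), ((m : ℝ), (3 : ℝ)),
    ((m : ℝ) - 2, (5 : ℝ)), ((0 : ℝ), (5 : ℝ)), ((0 : ℝ), (3 : ℝ))}

/-- Half-plane description. -/
def H18 (m : ℕ) : Set (ℝ × ℝ) :=
  {p | 0 ≤ p.1 ∧ p.1 ≤ m ∧ 0 ≤ p.2 ∧ p.2 ≤ 5 ∧ 3 ≤ p.1 + p.2 ∧ p.1 + p.2 ≤ m + 3}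

theorem H18_convex (m : ℕ) : Convex ℝ (H18 m) := by
  rintro ⟨x, y⟩ ⟨h1, h2, h3, h4, h5, h6⟩ ⟨x', y'⟩ ⟨k1, k2, k3, k4, k5, k6⟩ a b ha hb hab
  simp only at *
  obtain rfl : b = 1 - a := by linarith
  simp only [H18, Set.mem_ofPred_eq, Prod.fst_add, Prod.snd_add, Prod.smul_mk, smul_eq_mul]
  refine ⟨?_, ?_, ?_, ?_, ?_, ?_⟩ <;> nlinarith

theorem seg_mem {C : Set (ℝ × ℝ)} (hC : Convex ℝ C) {x1 y1 x2 y2 x y t : ℝ}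
    (h1 : (x1, y1) ∈ C) (h2 : (x2, y2) ∈ C) (ht0 : 0 ≤ t) (ht1 : t ≤ 1)
    (hx : x = (1 - t) * x1 + t * x2) (hy : y = (1 - t) * y1 + t * y2) : (x, y) ∈ C := by
  have := hC h1 h2 (by linarith : 0 ≤ 1 - t) ht0 (by ring)
  convert this using 1
  simp [hx, hy]

theorem row_mem {C : Set (ℝ × ℝ)} (hC : Convex ℝ C) {x1 x2 x y : ℝ}
    (h1 : (x1, y) ∈ C) (h2 : (x2, y) ∈ C) (hlt : x1 < x2) (hx1 : x1 ≤ x) (hx2 : x ≤ x2) :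
    (x, y) ∈ C := by
  have hp : 0 < x2 - x1 := by linarith
  refine seg_mem hC h1 h2 (t := (x - x1) / (x2 - x1)) (by apply div_nonneg <;> linarith)
    (by rw [div_le_one hp]; linarith) ?_ ?_
  · field_simp; ring
  · ring

theorem P18_eq (m : ℕ) (hm : 5 ≤ m) : P18 m = H18 m := by
  have hm' : (5 : ℝ) ≤ m := by exact_mod_cast hm
  apply Set.Subset.antisymm
  · apply convexHull_min _ (H18_convex m)
    intro p hp
    simp only [Set.mem_insert_iff, Set.mem_singleton_iff] at hp
    rcases hp with rfl | rfl | rfl | rfl | rfl | rfl <;> simp only [H18, Set.mem_ofPred_eq] <;>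
      refine ⟨?_, ?_, ?_, ?_, ?_, ?_⟩ <;> linarith
  · rintro ⟨x, y⟩ ⟨h1, h2, h3, h4, h5, h6⟩
    simp only at h1 h2 h3 h4 h5 h6
    have hC : Convex ℝ (P18 m) := convex_convexHull ℝ _
    have v1 : ((3 : ℝ), (0 : ℝ)) ∈ P18 m := subset_convexHull ℝ _ (by simp)
    have v2 : ((m : ℝ), (0 : ℝ)) ∈ P18 m := subset_convexHull ℝ _ (by simp)
    have v3 : ((m : ℝ), (3 : ℝ)) ∈ P18 m := subset_convexHull ℝ _ (by simp)
    have v4 : ((m : ℝ) - 2, (5 : ℝ)) ∈ P18 m := subset_convexHull ℝ _ (by simp)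
    have v5 : ((0 : ℝ), (5 : ℝ)) ∈ P18 m := subset_convexHull ℝ _ (by simp)
    have v6 : ((0 : ℝ), (3 : ℝ)) ∈ P18 m := subset_convexHull ℝ _ (by simp)
    rcases le_total y 3 with hy | hy
    · have l : (3 - y, y) ∈ P18 m :=
        seg_mem hC v1 v6 (t := y / 3) (by linarith) (by linarith) (by ring) (by ring)
      have r : ((m : ℝ), y) ∈ P18 m :=
        seg_mem hC v2 v3 (t := y / 3) (by linarith) (by linarith) (by ring) (by ring)
      exact row_mem hC l r (by linarith) (by linarith) (by linarith)
    · have l : ((0 : ℝ), y) ∈ P18 m :=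
        seg_mem hC v6 v5 (t := (y - 3) / 2) (by linarith) (by linarith) (by ring) (by ring)
      have r : ((m : ℝ) + 3 - y, y) ∈ P18 m :=
        seg_mem hC v3 v4 (t := (y - 3) / 2) (by linarith) (by linarith) (by ring) (by ring)
      exact row_mem hC l r (by linarith) (by linarith) (by linarith)

theorem H18_closed (m : ℕ) : IsClosed (H18 m) := by
  unfold H18
  repeat' apply IsClosed.and
  all_goals first
    | exact isClosed_le (by fun_prop) (by fun_prop)

theorem H18_interior (m : ℕ) : interior (H18 m) =
    {p : ℝ × ℝ | 0 < p.1 ∧ p.1 < m ∧ 0 < p.2 ∧ p.2 < 5 ∧ 3 < p.1 + p.2 ∧ p.1 + p.2 < m + 3} := by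
  apply Set.Subset.antisymm
  · rintro ⟨x, y⟩ hp
    rw [mem_interior_iff_mem_nhds, Metric.mem_nhds_iff] at hp
    obtain ⟨ε, hε, hb⟩ := hp
    have a1 : (x - ε / 2, y - ε / 2) ∈ H18 m := by
      apply hb
      simp only [Metric.mem_ball, Prod.dist_eq, Real.dist_eq]
      rw [max_lt_iff]
      constructor <;> rw [abs_lt] <;> constructor <;> linarith
    have a2 : (x + ε / 2, y + ε / 2) ∈ H18 m := by
      apply hb
      simp only [Metric.mem_ball, Prod.dist_eq, Real.dist_eq]
      rw [max_lt_iff]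
      constructor <;> rw [abs_lt] <;> constructor <;> linarith
    obtain ⟨h1, h2, h3, h4, h5, h6⟩ := a1
    obtain ⟨k1, k2, k3, k4, k5, k6⟩ := a2
    simp only at *
    refine ⟨?_, ?_, ?_, ?_, ?_, ?_⟩ <;> (try simp only) <;> linarith
  · apply interior_maximal
    · rintro p ⟨h1, h2, h3, h4, h5, h6⟩
      exact ⟨h1.le, h2.le, h3.le, h4.le, h5.le, h6.le⟩
    · repeat' apply IsOpen.and
      all_goals exact isOpen_lt (by fun_prop) (by fun_prop)

theorem embed_mem_H18 (m : ℕ) (p : ℤ × ℤ) : latticeEmbed p ∈ H18 m ↔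
    0 ≤ p.1 ∧ p.1 ≤ m ∧ 0 ≤ p.2 ∧ p.2 ≤ 5 ∧ 3 ≤ p.1 + p.2 ∧ p.1 + p.2 ≤ m + 3 := by
  simp only [H18, latticeEmbed, Set.mem_ofPred_eq]
  exact_mod_cast Iff.rfl

theorem embed_mem_int (m : ℕ) (p : ℤ × ℤ) : latticeEmbed p ∈ interior (H18 m) ↔
    0 < p.1 ∧ p.1 < m ∧ 0 < p.2 ∧ p.2 < 5 ∧ 3 < p.1 + p.2 ∧ p.1 + p.2 < m + 3 := by
  rw [H18_interior]
  simp only [latticeEmbed, Set.mem_ofPred_eq]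
  exact_mod_cast Iff.rfl

theorem genus18 (m : ℕ) (hm : 5 ≤ m) : polygonGenus (H18 m) = 4 * m - 8 := by
  have : interiorLatticePoints (H18 m) =
      (((Finset.Icc (1 : ℤ) 4).sigma fun y =>
        Finset.Icc (max (4 - y) 1) (min (m - 1 : ℤ) (m + 2 - y))).map
        ⟨fun s => (s.2, s.1), by rintro ⟨a, b⟩ ⟨c, d⟩ h; simp at h; obtain ⟨rfl, rfl⟩ := h; rfl⟩ :
        Finset (ℤ × ℤ)) := by
    ext ⟨x, y⟩
    simp only [interiorLatticePoints, Set.mem_ofPred_eq, embed_mem_int, Finset.coe_map,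
      Set.mem_image, Finset.mem_coe, Finset.mem_sigma, Finset.mem_Icc, Function.Embedding.coeFn_mk]
    constructor
    · intro h
      exact ⟨⟨y, x⟩, by dsimp only; omega, rfl⟩
    · rintro ⟨⟨y', x'⟩, h, he⟩
      obtain ⟨he1, he2⟩ := Prod.mk.inj he
      obtain rfl : x' = x := he1
      obtain rfl : y' = y := he2
      dsimp only at h
      omega
  rw [polygonGenus, this, Set.ncard_coe_finset, Finset.card_map, Finset.card_sigma,
    show Finset.Icc (1 : ℤ) 4 = {1, 2, 3, 4} by decide]
  simp
  omega

theorem bdry18 (m : ℕ) (hm : 5 ≤ m) : boundaryLatticeCount (H18 m) = 2 * m + 5 := by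
  have : {p : ℤ × ℤ | latticeEmbed p ∈ frontier (H18 m)} =
      (((Finset.Icc (0 : ℤ) 5).sigma fun y =>
        if y = 0 then Finset.Icc 3 (m : ℤ) else if y = 5 then Finset.Icc 0 (m - 2 : ℤ)
        else {max (3 - y) 0, min (m : ℤ) (m + 3 - y)}).map
        ⟨fun s => (s.2, s.1), by rintro ⟨a, b⟩ ⟨c, d⟩ h; simp at h; obtain ⟨rfl, rfl⟩ := h; rfl⟩ :
        Finset (ℤ × ℤ)) := by
    ext ⟨x, y⟩
    simp only [(H18_closed m).frontier_eq, Set.mem_sdiff, Set.mem_ofPred_eq, embed_mem_int,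
      embed_mem_H18, Finset.coe_map,
      Set.mem_image, Finset.mem_coe, Finset.mem_sigma, Function.Embedding.coeFn_mk]
    constructor
    · intro h
      refine ⟨⟨y, x⟩, ?_, rfl⟩
      dsimp only
      split_ifs <;> simp only [Finset.mem_Icc, Finset.mem_insert, Finset.mem_singleton] <;> omega
    · rintro ⟨⟨y', x'⟩, h, he⟩
      obtain ⟨he1, he2⟩ := Prod.mk.inj he
      dsimp only at h
      obtain rfl : x' = x := he1
      obtain rfl : y' = y := he2
      split_ifs at h <;>
        simp only [Finset.mem_Icc, Finset.mem_insert, Finset.mem_singleton] at h <;> omega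
  have c1 : ∀ y : ℤ, 1 ≤ y → y ≤ 4 →
      ({max (3 - y) 0, min (m : ℤ) (m + 3 - y)} : Finset ℤ).card = 2 := by
    intro y h1 h2
    apply Finset.card_pair
    omega
  rw [boundaryLatticeCount, this, Set.ncard_coe_finset, Finset.card_map, Finset.card_sigma,
    show Finset.Icc (0 : ℤ) 5 = {0, 1, 2, 3, 4, 5} by decide]
  rw [Finset.sum_insert (by decide), Finset.sum_insert (by decide), Finset.sum_insert (by decide),
    Finset.sum_insert (by decide), Finset.sum_insert (by decide), Finset.sum_singleton]
  rw [if_pos rfl, if_neg (by decide), if_neg (by decide), if_neg (by decide), if_neg (by decide),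
    if_neg (by decide), if_neg (by decide), if_neg (by decide), if_neg (by decide),
    if_neg (by decide), if_pos rfl, c1 1 (by decide) (by decide), c1 2 (by decide) (by decide),
    c1 3 (by decide) (by decide), c1 4 (by decide) (by decide), Int.card_Icc, Int.card_Icc]
  omega

/-- the general lower bound on widths -/
theorem width_lower {P : Set (ℝ × ℝ)} {w s : ℕ} {k x₀ y₀ x₁ y₁ x₂ y₂ : ℤ}
    (hx : (w : ℤ) ≤ k) (hy : |y₁ - y₂| = w)
    (h1 : latticeEmbed (x₀, y₀) ∈ P) (h2 : latticeEmbed (x₀ + k, y₀) ∈ P)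
    (h3 : latticeEmbed (x₁, y₁) ∈ P) (h4 : latticeEmbed (x₂, y₂) ∈ P)
    {φ : ℝ × ℝ → ℝ × ℝ} (hφ : IsZAffine φ) (hs : φ '' P ⊆ strip (s : ℝ)) : w ≤ s := by
  obtain ⟨a, b, c, d, e, f, hdet, hf⟩ := hφ
  have key : ∀ p : ℤ × ℤ, latticeEmbed p ∈ P → 0 ≤ c * p.1 + d * p.2 + f ∧
      c * p.1 + d * p.2 + f ≤ (s : ℤ) := by
    intro p hp
    have := hs ⟨_, hp, rfl⟩
    rw [hf] at this
    simp only [strip, latticeEmbed, Set.mem_ofPred_eq] at this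
    exact_mod_cast this
  have k1 := key _ h1
  have k2 := key _ h2
  have k3 := key _ h3
  have k4 := key _ h4
  simp only at k1 k2 k3 k4
  have hk0 : (0 : ℤ) ≤ w := by positivity
  by_contra hlt
  have hlt' : (s : ℤ) < w := by omega
  have hcd : c = 0 := by
    rcases lt_trichotomy c 0 with h | h | h
    · nlinarith
    · exact h
    · nlinarith
  subst hcd
  have hd : d = 1 ∨ d = -1 := by
    apply Int.isUnit_iff.1
    rcases hdet with h | h
    · exact IsUnit.of_mul_eq_one a (by linarith)
    · exact IsUnit.of_mul_eq_one (-a) (by linarith)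
  rcases abs_cases (y₁ - y₂) with ⟨h, _⟩ | ⟨h, _⟩ <;> rcases hd with rfl | rfl <;> omega

theorem width18_lower (m : ℕ) (hm : 5 ≤ m) {s : ℕ} {φ : ℝ × ℝ → ℝ × ℝ} (hφ : IsZAffine φ)
    (hs : φ '' (H18 m) ⊆ strip (s : ℝ)) : 5 ≤ s := by
  refine width_lower (w := 5) (k := m) (x₀ := 0) (y₀ := 3) (x₁ := 0) (y₁ := 5) (x₂ := 3) (y₂ := 0)
    (by exact_mod_cast hm) (by norm_num) ?_ ?_ ?_ ?_ hφ hs <;> rw [embed_mem_H18] <;> dsimp only <;> omega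

theorem width18 (m : ℕ) (hm : 5 ≤ m) : LatticeWidthIs (H18 m) 5 := by
  refine ⟨⟨by norm_num, id, ⟨1, 0, 0, 1, 0, 0, by norm_num, fun p => by simp⟩, ?_⟩, ?_⟩
  · rintro _ ⟨p, hp, rfl⟩
    obtain ⟨h1, h2, h3, h4, h5, h6⟩ := hp
    exact ⟨h3, by simpa using h4⟩
  · rintro s ⟨_, φ, hφ, hs⟩
    exact width18_lower m hm hφ hs

theorem width18_int (m : ℕ) (hm : 5 ≤ m) : LatticeWidthIs (interiorPolygon (H18 m)) 3 := by
  refine ⟨⟨by norm_num, fun p => (p.1, p.2 - 1), ⟨1, 0, 0, 1, 0, -1, by norm_num,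
    fun p => by simp [sub_eq_add_neg]⟩, ?_⟩, ?_⟩
  · have hsub : interiorPolygon (H18 m) ⊆ {p : ℝ × ℝ | 1 ≤ p.2} ∩ {p : ℝ × ℝ | p.2 ≤ 4} := by
      apply convexHull_min
      · rintro _ ⟨p, hp, rfl⟩
        simp only [interiorLatticePoints, Set.mem_ofPred_eq, embed_mem_int] at hp
        obtain ⟨h1, h2, h3, h4, h5, h6⟩ := hp
        simp only [latticeEmbed, Set.mem_inter_iff, Set.mem_ofPred_eq]
        have h3' : (1 : ℤ) ≤ p.2 := by omega
        have h4' : p.2 ≤ (4 : ℤ) := by omega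
        exact ⟨by exact_mod_cast h3', by exact_mod_cast h4'⟩
      · apply Convex.inter
        · exact convex_halfSpace_ge (IsLinearMap.mk (fun _ _ => rfl) (fun _ _ => rfl)) 1
        · exact convex_halfSpace_le (IsLinearMap.mk (fun _ _ => rfl) (fun _ _ => rfl)) 4
    rintro _ ⟨p, hp, rfl⟩
    have h := hsub hp
    simp only [Set.mem_inter_iff, Set.mem_ofPred_eq] at h
    simp only [strip, Set.mem_ofPred_eq]
    push_cast
    constructor <;> linarith
  · rintro s ⟨_, φ, hφ, hs⟩
    refine width_lower (w := 3) (k := m - 2) (x₀ := 1) (y₀ := 3) (x₁ := 1) (y₁ := 4) (x₂ := 3)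
      (y₂ := 1) (by push_cast; omega) (by norm_num) ?_ ?_ ?_ ?_ hφ hs <;>
    · refine subset_convexHull ℝ _ ⟨_, ?_, rfl⟩
      simp only [interiorLatticePoints, Set.mem_ofPred_eq, embed_mem_int]
      omega

theorem not_equiv18 (m : ℕ) (hm : 5 ≤ m) : ¬ EquivPolygon (H18 m) twoUpsilon := by
  rintro ⟨φ, ⟨a, b, c, d, e, f, hdet, hf⟩, himg⟩
  have hsub : twoUpsilon ⊆ {p : ℝ × ℝ | -2 ≤ p.2} ∩ {p : ℝ × ℝ | p.2 ≤ 2} := by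
    apply convexHull_min
    · intro p hp
      simp only [Set.mem_insert_iff, Set.mem_singleton_iff] at hp
      rcases hp with rfl | rfl | rfl <;> norm_num
    · apply Convex.inter
      · exact convex_halfSpace_ge (IsLinearMap.mk (fun _ _ => rfl) (fun _ _ => rfl)) (-2)
      · exact convex_halfSpace_le (IsLinearMap.mk (fun _ _ => rfl) (fun _ _ => rfl)) 2
  have := width18_lower m hm (s := 4) (φ := fun p => ((φ p).1, (φ p).2 + 2))
    ⟨a, b, c, d, e, f + 2, hdet, fun p => by simp only [hf]; push_cast; simp only [add_assoc]⟩ (by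
      rintro _ ⟨p, hp, rfl⟩
      have h := hsub (himg ▸ ⟨p, hp, rfl⟩ : φ p ∈ twoUpsilon)
      simp only [Set.mem_inter_iff, Set.mem_ofPred_eq] at h
      simp only [strip, Set.mem_ofPred_eq]
      push_cast
      constructor <;> linarith)
  omega

theorem collinear_det {τ : Set (ℝ × ℝ)} (h : Collinear ℝ τ) {p q r : ℤ × ℤ}
    (hp : latticeEmbed p ∈ τ) (hq : latticeEmbed q ∈ τ) (hr : latticeEmbed r ∈ τ) :
    (q.1 - p.1) * (r.2 - p.2) = (r.1 - p.1) * (q.2 - p.2) := by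
  obtain ⟨p₀, v, hv⟩ := (collinear_iff_exists_forall_eq_smul_vadd τ).1 h
  obtain ⟨a, ha⟩ := hv _ hp
  obtain ⟨b, hb⟩ := hv _ hq
  obtain ⟨c, hc⟩ := hv _ hr
  simp only [latticeEmbed, Prod.ext_iff, vadd_eq_add, Prod.fst_add, Prod.snd_add, Prod.smul_fst,
    Prod.smul_snd, smul_eq_mul] at ha hb hc
  have : ((q.1 : ℝ) - p.1) * (r.2 - p.2) = (r.1 - p.1) * (q.2 - p.2) := by
    rw [ha.1, ha.2, hb.1, hb.2, hc.1, hc.2]; ring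
  exact_mod_cast this

theorem no_column18 (m : ℕ) (hm : 5 ≤ m) (v : ℤ × ℤ) : ¬ IsColumnVector (H18 m) v := by
  rintro ⟨hv, τ, ⟨_, hfin⟩, hcol⟩
  have hc : Collinear ℝ τ := by
    rw [collinear_iff_finrank_le_one]; exact hfin.le
  obtain ⟨a, b⟩ := v
  have key : ∀ x y : ℤ, (0 ≤ x ∧ x ≤ m ∧ 0 ≤ y ∧ y ≤ 5 ∧ 3 ≤ x + y ∧ x + y ≤ m + 3) →
      ¬ (0 ≤ x + a ∧ x + a ≤ m ∧ 0 ≤ y + b ∧ y + b ≤ 5 ∧ 3 ≤ x + a + (y + b) ∧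
        x + a + (y + b) ≤ m + 3) → latticeEmbed (x, y) ∈ τ := by
    intro x y h1 h2
    by_contra hn
    have := hcol (x, y) ⟨(embed_mem_H18 m _).2 h1, hn⟩
    rw [embed_mem_H18] at this
    exact h2 this
  have hab : a ≠ 0 ∨ b ≠ 0 := by
    by_contra h
    push Not at h
    exact hv (by rw [h.1, h.2]; rfl)
  have K1 : b < 0 → latticeEmbed (3, 0) ∈ τ ∧ latticeEmbed ((m : ℤ), 0) ∈ τ := fun h =>
    ⟨key _ _ (by omega) (by omega), key _ _ (by omega) (by omega)⟩
  have K2 : 0 < b → latticeEmbed (0, 5) ∈ τ ∧ latticeEmbed ((m : ℤ) - 2, 5) ∈ τ := fun h =>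
    ⟨key _ _ (by omega) (by omega), key _ _ (by omega) (by omega)⟩
  have K3 : a < 0 → latticeEmbed (0, 3) ∈ τ ∧ latticeEmbed (0, 5) ∈ τ := fun h =>
    ⟨key _ _ (by omega) (by omega), key _ _ (by omega) (by omega)⟩
  have K4 : 0 < a → latticeEmbed ((m : ℤ), 0) ∈ τ ∧ latticeEmbed ((m : ℤ), 3) ∈ τ := fun h =>
    ⟨key _ _ (by omega) (by omega), key _ _ (by omega) (by omega)⟩
  have K5 : a + b < 0 → latticeEmbed (3, 0) ∈ τ ∧ latticeEmbed (0, 3) ∈ τ := fun h =>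
    ⟨key _ _ (by omega) (by omega), key _ _ (by omega) (by omega)⟩
  have K6 : 0 < a + b → latticeEmbed ((m : ℤ), 3) ∈ τ ∧ latticeEmbed ((m : ℤ) - 2, 5) ∈ τ :=
    fun h => ⟨key _ _ (by omega) (by omega), key _ _ (by omega) (by omega)⟩
  rcases lt_trichotomy b 0 with hb | hb | hb
  · obtain ⟨p1, p2⟩ := K1 hb
    rcases lt_trichotomy a 0 with ha | ha | ha
    · have := collinear_det hc p1 p2 (K3 ha).1
      simp only at this; omega
    · have := collinear_det hc p1 p2 (K5 (by omega)).2
      simp only at this; omega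
    · have := collinear_det hc p1 p2 (K4 ha).2
      simp only at this; omega
  · rcases lt_trichotomy a 0 with ha | ha | ha
    · have := collinear_det hc (K3 ha).1 (K3 ha).2 (K5 (by omega)).1
      simp only at this; omega
    · omega
    · have := collinear_det hc (K4 ha).1 (K4 ha).2 (K6 (by omega)).2
      simp only at this; omega
  · obtain ⟨p1, p2⟩ := K2 hb
    rcases lt_trichotomy a 0 with ha | ha | ha
    · have := collinear_det hc p1 p2 (K3 ha).1
      simp only at this; omega
    · have := collinear_det hc p1 p2 (K6 (by omega)).1
      simp only at this; omega
    · have := collinear_det hc p1 p2 (K4 ha).2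
      simp only at this; omega

/-- A point `p` of `P` which is strictly inside all half-planes that do not separate `q`
becomes interior after adding `q`. -/
theorem interior_of_beyond (m : ℕ) {Q : Set (ℝ × ℝ)} (hQ : Convex ℝ Q) (hPQ : H18 m ⊆ Q)
    {x y u v : ℝ} (hq : (u, v) ∈ Q)
    (h1 : 1 ≤ x ∨ (x = 0 ∧ u < 0))
    (h2 : 1 ≤ m - x ∨ (m - x = 0 ∧ m - u < 0))
    (h3 : 1 ≤ y ∨ (y = 0 ∧ v < 0))
    (h4 : 1 ≤ 5 - y ∨ (5 - y = 0 ∧ 5 - v < 0))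
    (h5 : 1 ≤ x + y - 3 ∨ (x + y - 3 = 0 ∧ u + v - 3 < 0))
    (h6 : 1 ≤ m + 3 - x - y ∨ (m + 3 - x - y = 0 ∧ m + 3 - u - v < 0)) :
    (x, y) ∈ interior Q := by
  set K : ℝ := |x - u| + |y - v| + 1 with hK
  have hKpos : 0 < K := by positivity
  set ε : ℝ := K⁻¹ with hε
  have hεpos : 0 < ε := by positivity
  have hεK : ε * K = 1 := inv_mul_cancel₀ hKpos.ne'
  have e1 : |ε * (x - u)| + |ε * (y - v)| < 1 := by
    rw [abs_mul, abs_mul, abs_of_pos hεpos]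
    nlinarith
  have b1 := abs_le.1 (le_refl |ε * (x - u)|)
  have b2 := abs_le.1 (le_refl |ε * (y - v)|)
  have n1 := abs_nonneg (ε * (x - u))
  have n2 := abs_nonneg (ε * (y - v))
  have hc : (x + ε * (x - u), y + ε * (y - v)) ∈ interior (H18 m) := by
    rw [H18_interior]
    refine ⟨?_, ?_, ?_, ?_, ?_, ?_⟩ <;> try simp only
    · rcases h1 with h | ⟨h, h'⟩
      · linarith
      · nlinarith
    · rcases h2 with h | ⟨h, h'⟩
      · linarith
      · nlinarith
    · rcases h3 with h | ⟨h, h'⟩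
      · linarith
      · nlinarith
    · rcases h4 with h | ⟨h, h'⟩
      · linarith
      · nlinarith
    · rcases h5 with h | ⟨h, h'⟩
      · linarith
      · nlinarith
    · rcases h6 with h | ⟨h, h'⟩
      · linarith
      · nlinarith
  have hc' := interior_mono hPQ hc
  refine hQ.openSegment_interior_self_subset_interior hc' hq ?_
  refine ⟨1 / (1 + ε), ε / (1 + ε), by positivity, by positivity, by field_simp, ?_⟩
  simp only [Prod.smul_mk, smul_eq_mul, Prod.mk_add_mk, Prod.mk.injEq]
  constructor <;> field_simp <;> ring

theorem maximal18 (m : ℕ) (hm : 5 ≤ m) : IsMaximalPolygon (H18 m) := by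
  constructor
  · refine ⟨{(3, 0), ((m : ℤ), 0), ((m : ℤ), 3), ((m : ℤ) - 2, 5), (0, 5), (0, 3)}, by simp, ?_⟩
    rw [← P18_eq m hm, P18]
    simp [latticeEmbed, Set.image_insert_eq]
  · rintro Q ⟨S, _, rfl⟩ hPQ hint
    apply Set.Subset.antisymm _ hPQ
    apply convexHull_min _ (H18_convex m)
    rintro _ ⟨⟨u, v⟩, hq, rfl⟩
    have hq' := subset_convexHull ℝ _ (Set.mem_image_of_mem latticeEmbed hq)
    have hQ := convex_convexHull ℝ (latticeEmbed '' (S : Set (ℤ × ℤ)))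
    have key : ∀ x y : ℤ,
      (1 ≤ x ∨ (x = 0 ∧ u < 0)) →
      (1 ≤ m - x ∨ (m - x = 0 ∧ m - u < 0)) →
      (1 ≤ y ∨ (y = 0 ∧ v < 0)) →
      (1 ≤ 5 - y ∨ (5 - y = 0 ∧ 5 - v < 0)) →
      (1 ≤ x + y - 3 ∨ (x + y - 3 = 0 ∧ u + v - 3 < 0)) →
      (1 ≤ m + 3 - x - y ∨ (m + 3 - x - y = 0 ∧ m + 3 - u - v < 0)) →
      (0 < x ∧ x < m ∧ 0 < y ∧ y < 5 ∧ 3 < x + y ∧ x + y < m + 3) := by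
      intro x y h1 h2 h3 h4 h5 h6
      have hi : (x, y) ∈ interiorLatticePoints (H18 m) := by
        rw [← hint]
        exact interior_of_beyond m hQ hPQ hq' (by exact_mod_cast h1) (by exact_mod_cast h2)
          (by exact_mod_cast h3) (by exact_mod_cast h4) (by exact_mod_cast h5)
          (by exact_mod_cast h6)
      exact (embed_mem_int m _).1 hi
    rw [embed_mem_H18]
    dsimp only
    refine ⟨?_, ?_, ?_, ?_, ?_, ?_⟩ <;> by_contra hcon
    · have := key 0 4; omega
    · have := key m 1; omega
    · have := key 4 0; omega
    · have := key 1 5; omega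
    · have := key 1 2; omega
    · have := key (m - 1) 4; omega

/-- For `g ≥ 12` with `g ≡ 0 (mod 4)` and `m = g/4 + 2`, the polygon `P18 m` is a
maximal lattice polygon of genus `g`, lattice width `5`, expected gonality `5`, has no
column vectors, and satisfies `g + r(P) − 3 = 3g/2 + 6`. -/
theorem stmt18 (g : ℕ) (hg : 12 ≤ g) (hmod : g % 4 = 0) :
    IsMaximalPolygon (P18 (g / 4 + 2)) ∧
    polygonGenus (P18 (g / 4 + 2)) = g ∧
    LatticeWidthIs (P18 (g / 4 + 2)) 5 ∧
    ExpectedGonalityIs (P18 (g / 4 + 2)) 5 ∧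
    (∀ v : ℤ × ℤ, ¬ IsColumnVector (P18 (g / 4 + 2)) v) ∧
    (g : ℚ) + (boundaryLatticeCount (P18 (g / 4 + 2)) : ℚ) - 3 =
      3 * (g : ℚ) / 2 + 6 := by
  obtain ⟨m, hm, hgm, hg4⟩ : ∃ m : ℕ, 5 ≤ m ∧ g / 4 + 2 = m ∧ g + 8 = 4 * m :=
    ⟨g / 4 + 2, by omega, rfl, by omega⟩
  rw [hgm, P18_eq m hm]
  refine ⟨maximal18 m hm, ?_, width18 m hm, Or.inr ⟨not_equiv18 m hm, 3, width18_int m hm, rfl⟩,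
    no_column18 m hm, ?_⟩
  · rw [genus18 m hm]; omega
  · rw [bdry18 m hm]
    have : (g : ℚ) + 8 = 4 * m := by exact_mod_cast hg4
    push_cast
    linarith
end
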